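/- arXiv:2106.01050 — 3 statements merged into one kernel-verified Lean document; each statement's English description precedes it below -/
import Mathlib

section
/- The contraction [x→v←y] is order-preserving with respect to the second higher Stasheff–Tamari order: if 1 < v < m and T̂, T̂' are triangulations of C([m]_{v+}, n) with T̂ ≤₂ T̂', then T̂[x→v←y] ≤₂ T̂'[x→v←y] as triangulations of C(m,n). -/
open scoped Classical

namespace HST

/-- `AltChain l₁ l₂` holds when the alternating merge of the two lists, starting with the
head of `l₁`, is strictly increasing: `a₀ < b₀ < a₁ < b₁ < ⋯`.  The lengths must satisfy
`l₂.length ≤ l₁.length ≤ l₂.length + 1`. -/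
def AltChain : List ℚ → List ℚ → Prop
  | [], [] => True
  | [], _ :: _ => False
  | [_], [] => True
  | _ :: _ :: _, [] => False
  | a :: as, b :: bs => a < b ∧ AltChain (b :: bs) as
termination_by l₁ l₂ => l₁.length + l₂.length
decreasing_by simp; omega

/-- The alternating merge starting with the least element of `A`. -/
def Intertwines (A B : Finset ℚ) : Prop :=
  AltChain (A.sort (· ≤ ·)) (B.sort (· ≤ ·))

/-- The paper's intertwining relation `A ≀ B`: for `#A = #B = k + 1` it means
`a₀ < b₀ < a₁ < b₁ < ⋯ < a_k < b_k`; for `#A = #B - 1` it means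
`b₀ < a₀ < b₁ < a₁ < ⋯ < b_k`. -/
def Wr (A B : Finset ℚ) : Prop :=
  if A.card = B.card then Intertwines A B else Intertwines B A

/-- Gale's evenness criterion: upper facets of the cyclic polytope with vertex set `V`. -/
def IsUpperFacet (V : Finset ℚ) (n : ℕ) (F : Finset ℚ) : Prop :=
  F ⊆ V ∧ F.card = n ∧ ∀ w ∈ V \ F, Odd ((F.filter fun x => w < x).card)

/-- Gale's evenness criterion: lower facets of the cyclic polytope with vertex set `V`. -/
def IsLowerFacet (V : Finset ℚ) (n : ℕ) (F : Finset ℚ) : Prop :=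
  F ⊆ V ∧ F.card = n ∧ ∀ w ∈ V \ F, Even ((F.filter fun x => w < x).card)

def IsFacet (V : Finset ℚ) (n : ℕ) (F : Finset ℚ) : Prop :=
  IsUpperFacet V n F ∨ IsLowerFacet V n F

/-- The circuits of the cyclic polytope `C(V, n)`. -/
def IsCircuit (V : Finset ℚ) (n : ℕ) (Zp Zm : Finset ℚ) : Prop :=
  Zp ⊆ V ∧ Zm ⊆ V ∧
    ((Zp.card = n / 2 + 1 ∧ Zm.card = (n + 1) / 2 + 1 ∧ Wr Zp Zm) ∨
      (Zm.card = n / 2 + 1 ∧ Zp.card = (n + 1) / 2 + 1 ∧ Wr Zm Zp))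

/-- Combinatorial triangulations of the cyclic polytope `C(V, n)`. -/
def IsTriangulation (V : Finset ℚ) (n : ℕ) (T : Finset (Finset ℚ)) : Prop :=
  (∀ S ∈ T, S ⊆ V ∧ S.card = n + 1) ∧
    (∀ S ∈ T, ∀ F ⊆ S, F.card = n →
      (∃ G, IsFacet V n G ∧ F ⊆ G) ∨ ∃ R ∈ T, R ≠ S ∧ F ⊆ R) ∧
    (∀ S ∈ T, ∀ R ∈ T, ∀ Zp Zm, IsCircuit V n Zp Zm → ¬(Zp ⊆ S ∧ Zm ⊆ R))

noncomputable def lowerFacets (V : Finset ℚ) (n : ℕ) : Finset (Finset ℚ) :=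
  V.powerset.filter fun F => IsLowerFacet V n F

noncomputable def upperFacets (V : Finset ℚ) (n : ℕ) : Finset (Finset ℚ) :=
  V.powerset.filter fun F => IsUpperFacet V n F

/-- `T'` is an increasing bistellar flip of `T`. -/
def IsIncFlip (V : Finset ℚ) (n : ℕ) (T T' : Finset (Finset ℚ)) : Prop :=
  ∃ U, U ⊆ V ∧ U.card = n + 2 ∧ lowerFacets U (n + 1) ⊆ T ∧
    T' = (T \ lowerFacets U (n + 1)) ∪ upperFacets U (n + 1)

/-- The first higher Stasheff–Tamari order. -/
def Le1 (V : Finset ℚ) (n : ℕ) : Finset (Finset ℚ) → Finset (Finset ℚ) → Prop :=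
  Relation.ReflTransGen (IsIncFlip V n)

/-- `simp(T)`: the internal `⌊n/2⌋`-simplices of a triangulation `T` of `C(V, n)`. -/
noncomputable def internalSimps (V : Finset ℚ) (n : ℕ) (T : Finset (Finset ℚ)) :
    Finset (Finset ℚ) :=
  V.powerset.filter fun A =>
    A.card = n / 2 + 1 ∧ (∃ S ∈ T, A ⊆ S) ∧ ∀ F, IsFacet V n F → ¬A ⊆ F

/-- The second higher Stasheff–Tamari order in even dimension `n = 2d`. -/
def Le2Even (V : Finset ℚ) (d : ℕ) (T T' : Finset (Finset ℚ)) : Prop :=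
  ∀ A ∈ internalSimps V (2 * d) T, ∀ B ∈ internalSimps V (2 * d) T', ¬Wr B A

/-- The second higher Stasheff–Tamari order in odd dimension `n = 2d + 1`. -/
def Le2Odd (V : Finset ℚ) (d : ℕ) (T T' : Finset (Finset ℚ)) : Prop :=
  internalSimps V (2 * d + 1) T' ⊆ internalSimps V (2 * d + 1) T

/-- The second higher Stasheff–Tamari order. -/
def Le2 (V : Finset ℚ) (n : ℕ) (T T' : Finset (Finset ℚ)) : Prop :=
  if Even n then ∀ A ∈ internalSimps V n T, ∀ B ∈ internalSimps V n T', ¬Wr B A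
  else internalSimps V n T' ⊆ internalSimps V n T

/-- The vertex set `[m] = {1, …, m}`, realised inside `ℚ`. -/
noncomputable def vSet (m : ℕ) : Finset ℚ := (Finset.Icc 1 m).image fun i => (i : ℚ)

/-- `C(U, n)` is a subpolytope of the triangulation `T`. -/
def IsSubpolytope (n : ℕ) (T : Finset (Finset ℚ)) (U : Finset ℚ) : Prop :=
  IsTriangulation U n (T.filter fun S => S ⊆ U)

/-- Contraction of a triangulation along a vertex map `c`. -/
noncomputable def contractTri (c : ℚ → ℚ) (n : ℕ) (T : Finset (Finset ℚ)) :
    Finset (Finset ℚ) :=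
  (T.image fun S => S.image c).filter fun S => S.card = n + 1

/-- The vertex map of the contraction `[m - 1 ← m]`. -/
def topMap (m : ℚ) (a : ℚ) : ℚ := if a = m then m - 1 else a

/-- The vertex map of the contraction `[1 → 2]`. -/
def botMap (a : ℚ) : ℚ := if a = 1 then 2 else a

/-- The vertex `x` of `[N]_{v+}`, realised in `ℚ`. -/
def xOf (v : ℕ) : ℚ := (v : ℚ) - 1/3

/-- The vertex `y` of `[N]_{v+}`, realised in `ℚ`. -/
def yOf (v : ℕ) : ℚ := (v : ℚ) + 1/3

/-- The vertex set `[N]_{v+} = {1, …, v - 1, x, y, v + 1, …, N}`. -/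
noncomputable def vPlus (N v : ℕ) : Finset ℚ :=
  insert (xOf v) (insert (yOf v) ((vSet N).erase (v : ℚ)))

/-- The vertex map of the contraction `[x → v ← y]`. -/
def midMap (v : ℕ) (a : ℚ) : ℚ := if a = xOf v ∨ a = yOf v then (v : ℚ) else a

/-- `U_{v+}` for a subset `U` of `[N]`. -/
noncomputable def setVPlus (v : ℕ) (U : Finset ℚ) : Finset ℚ :=
  if (v : ℚ) ∈ U then insert (xOf v) (insert (yOf v) (U.erase (v : ℚ))) else U

/-- `I(m, d)`: the internal `d`-simplices of `C(m, 2d)`. -/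
noncomputable def Iset (m d : ℕ) : Finset (Finset ℚ) :=
  (vSet m).powerset.filter fun A =>
    A.card = d + 1 ∧ (∀ a ∈ A, a + 1 ∉ A) ∧ ¬((1 : ℚ) ∈ A ∧ (m : ℚ) ∈ A)

/-- `O(m, d)`: the internal `d`-simplices of `C(m, 2d + 1)`. -/
noncomputable def Oset (m d : ℕ) : Finset (Finset ℚ) :=
  (Iset m d).filter fun A => (1 : ℚ) ∉ A ∧ (m : ℚ) ∉ A


lemma vSet_eq (m : ℕ) : vSet m = (Finset.Icc 1 m).image (Nat.cast : ℕ → ℚ) := by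
  ext a
  simp [vSet, Finset.bind_def, Finset.pure_def, eq_comm]

lemma mem_vSet {m : ℕ} {a : ℚ} : a ∈ vSet m ↔ ∃ i : ℕ, (1 ≤ i ∧ i ≤ m) ∧ (i : ℚ) = a := by
  simp [vSet_eq]

lemma mem_vPlus {m v : ℕ} {a : ℚ} (h : a ∈ vPlus m v) :
    a = xOf v ∨ a = yOf v ∨ (a ∈ vSet m ∧ (a + 1 ≤ v ∨ (v : ℚ) + 1 ≤ a)) := by
  simp only [vPlus, Finset.mem_insert, Finset.mem_erase] at h
  rcases h with h | h | ⟨h, h'⟩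
  · exact .inl h
  · exact .inr (.inl h)
  · refine .inr (.inr ⟨h', ?_⟩)
    obtain ⟨i, -, rfl⟩ := mem_vSet.1 h'
    have : i ≠ v := by rintro rfl; exact h rfl
    rcases Nat.lt_or_gt_of_ne this with h | h
    · left; exact_mod_cast h
    · right; exact_mod_cast h

lemma midMap_xOf (v : ℕ) : midMap v (xOf v) = v := by simp [midMap]

lemma midMap_yOf (v : ℕ) : midMap v (yOf v) = v := by simp [midMap]

lemma midMap_of_far {v : ℕ} {a : ℚ} (h : a + 1 ≤ v ∨ (v : ℚ) + 1 ≤ a) : midMap v a = a := by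
  rw [midMap, if_neg]
  rintro (rfl | rfl) <;> rcases h with h | h <;> simp only [xOf, yOf] at h <;> linarith

lemma far_of_mem_vSet {m v : ℕ} {a : ℚ} (h : a ∈ vSet m) (hv : a ≠ v) :
    a ∈ vPlus m v ∧ (a + 1 ≤ v ∨ (v : ℚ) + 1 ≤ a) := by
  have ha : a ∈ vPlus m v := by simp [vPlus, h, hv]
  refine ⟨ha, ?_⟩
  obtain ⟨i, -, rfl⟩ := mem_vSet.1 h
  have : i ≠ v := by rintro rfl; exact hv rfl
  rcases Nat.lt_or_gt_of_ne this with h | h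
  · left; exact_mod_cast h
  · right; exact_mod_cast h

lemma midMap_mem_vSet {m v : ℕ} (hv1 : 1 < v) (hvm : v < m) {a : ℚ} (h : a ∈ vPlus m v) :
    midMap v a ∈ vSet m := by
  have hv : (v : ℚ) ∈ vSet m :=
    mem_vSet.2 ⟨v, ⟨hv1.le, hvm.le⟩, rfl⟩
  rcases mem_vPlus h with rfl | rfl | ⟨h, h'⟩
  · rwa [midMap_xOf]
  · rwa [midMap_yOf]
  · rwa [midMap_of_far h']

lemma lt_of_midMap_lt {m v : ℕ} {a b : ℚ} (ha : a ∈ vPlus m v) (hb : b ∈ vPlus m v)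
    (h : midMap v a < midMap v b) : a < b := by
  rcases mem_vPlus ha with rfl | rfl | ⟨-, ha⟩ <;> rcases mem_vPlus hb with rfl | rfl | ⟨-, hb⟩ <;>
    simp only [midMap_xOf, midMap_yOf, midMap_of_far, *] at h ⊢ <;>
    first
    | exact h
    | exact absurd h (lt_irrefl _)
    | (rcases ha with ha | ha <;> simp only [xOf, yOf] <;> linarith)
    | (rcases hb with hb | hb <;> simp only [xOf, yOf] <;> linarith)

lemma xOf_ne_yOf (v : ℕ) : xOf v ≠ yOf v := by
  intro h; simp only [xOf, yOf] at h; linarith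

/-- `midMap v` only identifies `xOf v` and `yOf v`. -/
lemma eq_of_midMap_eq {m v : ℕ} {a b : ℚ} (ha : a ∈ vPlus m v) (hb : b ∈ vPlus m v)
    (h : midMap v a = midMap v b) :
    a = b ∨ (a = xOf v ∧ b = yOf v) ∨ (a = yOf v ∧ b = xOf v) := by
  rcases mem_vPlus ha with rfl | rfl | ⟨-, ha⟩ <;> rcases mem_vPlus hb with rfl | rfl | ⟨-, hb⟩ <;>
    simp only [midMap_xOf, midMap_yOf, midMap_of_far, *] at h ⊢ <;>
    first
    | (simp; done)
    | exact .inl h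
    | (rcases ha with ha | ha <;> linarith)
    | (rcases hb with hb | hb <;> linarith)

lemma injOn_midMap {m v : ℕ} {S : Finset ℚ} (hS : S ⊆ vPlus m v)
    (h : ¬(xOf v ∈ S ∧ yOf v ∈ S)) : Set.InjOn (midMap v) S := by
  intro a ha b hb hab
  rcases eq_of_midMap_eq (hS ha) (hS hb) hab with h' | ⟨rfl, rfl⟩ | ⟨rfl, rfl⟩
  · exact h'
  · exact absurd ⟨ha, hb⟩ h
  · exact absurd ⟨hb, ha⟩ h

lemma card_filter_image_midMap {m v : ℕ} {G : Finset ℚ} (hG : G ⊆ vPlus m v)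
    (hinj : Set.InjOn (midMap v) G) {w u : ℚ} (hw : u ∈ vPlus m v) (hu : midMap v u = w)
    (hwG : w ∉ G.image (midMap v)) :
    ((G.image (midMap v)).filter fun a => w < a).card = (G.filter fun a => u < a).card := by
  rw [Finset.filter_image, Finset.card_image_of_injOn
    (hinj.mono fun a ha => (Finset.mem_filter.1 ha).1)]
  congr 1
  refine Finset.filter_congr fun a ha => ?_
  have hne : midMap v a ≠ w := fun h => hwG (h ▸ Finset.mem_image_of_mem _ ha)
  subst hu
  refine ⟨lt_of_midMap_lt hw (hG ha), fun h => ?_⟩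
  by_contra h'
  exact absurd (lt_of_midMap_lt (hG ha) hw (lt_of_le_of_ne (not_lt.1 h') hne)) h.not_gt

lemma exists_lift_vSet {m v : ℕ} {w : ℚ} (hw : w ∈ vSet m) :
    ∃ u ∈ vPlus m v, midMap v u = w := by
  by_cases h : w = v
  · exact ⟨xOf v, by simp [vPlus], by rw [midMap_xOf, h]⟩
  · obtain ⟨h1, h2⟩ := far_of_mem_vSet hw h
    exact ⟨w, h1, midMap_of_far h2⟩

/-- Contracted facets extend to facets; `P` is the parity condition of Gale's criterion. -/
lemma exists_gale_superset {m n v : ℕ} (hmn : n + 2 ≤ m) (hv1 : 1 < v) (hvm : v < m)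
    (P : ℕ → Prop) {G : Finset ℚ} (hG : G ⊆ vPlus m v) (hn : G.card = n)
    (hP : ∀ w ∈ vPlus m v \ G, P (G.filter fun a => w < a).card) :
    ∃ G' ⊆ vSet m, G'.card = n ∧ (∀ w ∈ vSet m \ G', P (G'.filter fun a => w < a).card) ∧
      G.image (midMap v) ⊆ G' := by
  by_cases hxy : xOf v ∈ G ∧ yOf v ∈ G
  · obtain ⟨hx, hy⟩ := hxy
    set K := G.erase (yOf v) with hK
    have hKV : K ⊆ vPlus m v := (Finset.erase_subset _ _).trans hG
    have hinj : Set.InjOn (midMap v) K := injOn_midMap hKV (by simp [hK])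
    set H := K.image (midMap v) with hH
    have hHV : H ⊆ vSet m :=
      Finset.image_subset_iff.2 fun a ha => midMap_mem_vSet hv1 hvm (hKV ha)
    have hHc : H.card + 1 = n := by
      rw [hH, Finset.card_image_of_injOn hinj, ← hn]
      exact Finset.card_erase_add_one hy
    have hvH : (v : ℚ) ∈ H :=
      Finset.mem_image.2 ⟨xOf v, Finset.mem_erase.2 ⟨xOf_ne_yOf v, hx⟩, midMap_xOf v⟩
    have hGH : G.image (midMap v) ⊆ H := by
      refine Finset.image_subset_iff.2 fun a ha => ?_
      by_cases h : a = yOf v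
      · rwa [h, midMap_yOf]
      · exact Finset.mem_image_of_mem _ (Finset.mem_erase.2 ⟨h, ha⟩)
    have hwv : ∀ w ∉ H, w ≠ v := fun w hw h => hw (h ▸ hvH)
    have hwG : ∀ w ∈ vSet m, w ∉ H → w ∈ vPlus m v \ G := fun w hw hwH => by
      obtain ⟨h1, h2⟩ := far_of_mem_vSet hw (hwv w hwH)
      refine Finset.mem_sdiff.2 ⟨h1, fun h => hwH (hGH ?_)⟩
      exact Finset.mem_image.2 ⟨w, h, midMap_of_far h2⟩
    have hcount : ∀ w ∈ vSet m, w ∉ H →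
        (H.filter fun a => w < a).card = (K.filter fun a => w < a).card := fun w hw hwH => by
      obtain ⟨h1, h2⟩ := far_of_mem_vSet hw (hwv w hwH)
      exact card_filter_image_midMap hKV hinj h1 (midMap_of_far h2) hwH
    have hKG : G = insert (yOf v) K := (Finset.insert_erase hy).symm
    have hyK : yOf v ∉ K := Finset.notMem_erase _ _
    have habove : ∀ w ∈ vSet m, w ∉ H → (v : ℚ) < w →
        (H.filter fun a => w < a).card = (G.filter fun a => w < a).card := fun w hw hwH h => by
      obtain ⟨-, h2⟩ := far_of_mem_vSet hw (hwv w hwH)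
      rw [hcount w hw hwH, hKG, Finset.filter_insert, if_neg]
      simp only [yOf]
      rcases h2 with h2 | h2 <;> linarith
    have hbelow : ∀ w ∈ vSet m, w ∉ H → w < v →
        (H.filter fun a => w < a).card + 1 = (G.filter fun a => w < a).card :=
      fun w hw hwH h => by
        rw [hcount w hw hwH, hKG, Finset.filter_insert, if_pos, Finset.card_insert_of_notMem]
        · simp [hyK]
        · simp only [yOf]; linarith
    by_cases hlow : ((vSet m \ H).filter fun w => w < (v : ℚ)).Nonempty
    · obtain ⟨w₀, hw₀, hmax⟩ := Finset.exists_max_image _ id hlow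
      simp only [Finset.mem_filter, Finset.mem_sdiff, id, and_imp] at hw₀ hmax
      obtain ⟨⟨hw₀V, hw₀H⟩, hw₀v⟩ := hw₀
      refine ⟨insert w₀ H, Finset.insert_subset hw₀V hHV, ?_, ?_,
        hGH.trans (Finset.subset_insert _ _)⟩
      · rw [Finset.card_insert_of_notMem hw₀H, hHc]
      · intro w hw
        simp only [Finset.mem_sdiff, Finset.mem_insert, not_or] at hw
        obtain ⟨hwV, hw0, hwH⟩ := hw
        have hPw := hP w (hwG w hwV hwH)
        rcases lt_or_gt_of_ne (hwv w hwH) with h | h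
        · have hlt : w < w₀ := lt_of_le_of_ne (hmax w hwV hwH h) hw0
          rw [Finset.filter_insert, if_pos hlt, Finset.card_insert_of_notMem (by simp [hw₀H]),
            hbelow w hwV hwH h]
          exact hPw
        · rw [Finset.filter_insert, if_neg (by linarith), habove w hwV hwH h]
          exact hPw
    · have hlow' : ∀ w ∈ vSet m, w ∉ H → (v : ℚ) < w := fun w hw hwH => by
        refine lt_of_le_of_ne (not_lt.1 fun h => hlow ⟨w, ?_⟩) (hwv w hwH).symm
        simp [hw, hwH, h]
      have hne : (vSet m \ H).Nonempty := by
        have hcard : (vSet m).card = m := by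
          rw [vSet_eq, Finset.card_image_of_injective _ Nat.cast_injective]; simp
        rw [Finset.nonempty_iff_ne_empty, Ne, Finset.sdiff_eq_empty_iff_subset]
        intro h
        have := Finset.card_le_card h
        omega
      obtain ⟨w₀, hw₀, hmin⟩ := Finset.exists_min_image _ id hne
      simp only [Finset.mem_sdiff, id, and_imp] at hw₀ hmin
      obtain ⟨hw₀V, hw₀H⟩ := hw₀
      refine ⟨insert w₀ H, Finset.insert_subset hw₀V hHV, ?_, ?_,
        hGH.trans (Finset.subset_insert _ _)⟩
      · rw [Finset.card_insert_of_notMem hw₀H, hHc]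
      · intro w hw
        simp only [Finset.mem_sdiff, Finset.mem_insert, not_or] at hw
        obtain ⟨hwV, -, hwH⟩ := hw
        rw [Finset.filter_insert, if_neg (hmin w hwV hwH).not_gt,
          habove w hwV hwH (hlow' w hwV hwH)]
        exact hP w (hwG w hwV hwH)
  · have hinj := injOn_midMap hG hxy
    refine ⟨G.image (midMap v),
      Finset.image_subset_iff.2 fun a ha => midMap_mem_vSet hv1 hvm (hG ha),
      by rw [Finset.card_image_of_injOn hinj, hn], fun w hw => ?_, subset_rfl⟩
    obtain ⟨hwV, hwG⟩ := Finset.mem_sdiff.1 hw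
    obtain ⟨u, hu, huw⟩ := exists_lift_vSet (v := v) hwV
    rw [card_filter_image_midMap hG hinj hu huw hwG]
    exact hP u (Finset.mem_sdiff.2 ⟨hu, fun h => hwG (huw ▸ Finset.mem_image_of_mem _ h)⟩)

lemma IsFacet.exists_image_midMap_subset {m n v : ℕ} (hmn : n + 2 ≤ m) (hv1 : 1 < v)
    (hvm : v < m) {G : Finset ℚ} (hG : IsFacet (vPlus m v) n G) :
    ∃ G', IsFacet (vSet m) n G' ∧ G.image (midMap v) ⊆ G' := by
  rcases hG with ⟨h1, h2, h3⟩ | ⟨h1, h2, h3⟩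
  · obtain ⟨G', g1, g2, g3, g4⟩ := exists_gale_superset hmn hv1 hvm Odd h1 h2 h3
    exact ⟨G', .inl ⟨g1, g2, g3⟩, g4⟩
  · obtain ⟨G', g1, g2, g3, g4⟩ := exists_gale_superset hmn hv1 hvm Even h1 h2 h3
    exact ⟨G', .inr ⟨g1, g2, g3⟩, g4⟩

/-- Internal simplices of a contraction lift to internal simplices. -/
lemma exists_lift_internalSimps {m n v : ℕ} (hmn : n + 2 ≤ m) (hv1 : 1 < v) (hvm : v < m)
    {T : Finset (Finset ℚ)} (hT : IsTriangulation (vPlus m v) n T) {A : Finset ℚ}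
    (hA : A ∈ internalSimps (vSet m) n (contractTri (midMap v) n T)) :
    ∃ B ∈ internalSimps (vPlus m v) n T, B.image (midMap v) = A ∧
      Set.InjOn (midMap v) B := by
  simp only [internalSimps, contractTri, Finset.mem_filter, Finset.mem_image] at hA
  obtain ⟨-, hc, ⟨_, ⟨⟨S, hS, rfl⟩, hSc⟩, hAS⟩, hint⟩ := hA
  obtain ⟨B, hBS, rfl⟩ := Finset.subset_image_iff.1 hAS
  have hBS' : B ⊆ S := by exact_mod_cast hBS
  obtain ⟨hSV, hSn⟩ := hT.1 S hS
  have hinj : Set.InjOn (midMap v) S := Finset.card_image_iff.1 (hSc.trans hSn.symm)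
  have hinjB : Set.InjOn (midMap v) B := hinj.mono (by exact_mod_cast hBS)
  refine ⟨B, ?_, rfl, hinjB⟩
  simp only [internalSimps, Finset.mem_filter, Finset.mem_powerset]
  refine ⟨hBS'.trans hSV, by rw [← hc, Finset.card_image_of_injOn hinjB], ⟨S, hS, hBS'⟩,
    fun F hF hBF => ?_⟩
  obtain ⟨G', hG', hsub⟩ := hF.exists_image_midMap_subset hmn hv1 hvm
  exact hint G' hG' ((Finset.image_subset_image hBF).trans hsub)

/-- An internal simplex on which the contraction is injective lies in a simplex that is not
collapsed. -/
lemma exists_not_collapsed {m n v : ℕ} {T : Finset (Finset ℚ)}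
    (hT : IsTriangulation (vPlus m v) n T) {B : Finset ℚ}
    (hB : B ∈ internalSimps (vPlus m v) n T) (hinj : Set.InjOn (midMap v) B) :
    ∃ R ∈ T, B ⊆ R ∧ ¬(xOf v ∈ R ∧ yOf v ∈ R) := by
  simp only [internalSimps, Finset.mem_filter] at hB
  obtain ⟨-, -, ⟨S, hS, hBS⟩, hint⟩ := hB
  by_cases hxy : xOf v ∈ S ∧ yOf v ∈ S
  · obtain ⟨z, hz, hzB, hzS⟩ : ∃ z, (z = xOf v ∨ z = yOf v) ∧ z ∉ B ∧ z ∈ S := by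
      by_cases hx : xOf v ∈ B
      · refine ⟨yOf v, .inr rfl, fun hy => xOf_ne_yOf v (hinj hx hy ?_), hxy.2⟩
        rw [midMap_xOf, midMap_yOf]
      · exact ⟨xOf v, .inl rfl, hx, hxy.1⟩
    have hBz : B ⊆ S.erase z := fun a ha =>
      Finset.mem_erase.2 ⟨fun h => hzB (h ▸ ha), hBS ha⟩
    have hSc := (hT.1 S hS).2
    rcases hT.2.1 S hS (S.erase z) (Finset.erase_subset _ _)
      (by rw [Finset.card_erase_of_mem hzS, hSc]; rfl) with ⟨G, hG, hsub⟩ | ⟨R, hR, hne, hsub⟩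
    · exact absurd (hBz.trans hsub) (hint G hG)
    · have hzR : z ∉ R := fun h => by
        refine hne (Finset.eq_of_subset_of_card_le (fun a ha => ?_) ?_).symm
        · by_cases haz : a = z
          · exact haz ▸ h
          · exact hsub (Finset.mem_erase.2 ⟨haz, ha⟩)
        · rw [hSc, (hT.1 R hR).2]
      refine ⟨R, hR, hBz.trans hsub, ?_⟩
      rintro ⟨h1, h2⟩
      rcases hz with rfl | rfl
      · exact hzR h1
      · exact hzR h2
  · exact ⟨S, hS, hBS, hxy⟩

lemma AltChain.of_map {f : ℚ → ℚ} {V : Finset ℚ}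
    (hf : ∀ a ∈ V, ∀ b ∈ V, f a < f b → a < b) (l₁ l₂ : List ℚ) :
    (∀ a ∈ l₁, a ∈ V) → (∀ a ∈ l₂, a ∈ V) → AltChain (l₁.map f) (l₂.map f) →
      AltChain l₁ l₂ := by
  induction l₁, l₂ using AltChain.induct with
  | case1 => simp
  | case2 => simp [AltChain]
  | case3 => simp [AltChain]
  | case4 => simp [AltChain]
  | case5 a as b bs ih =>
    intro h₁ h₂ h
    simp only [List.map_cons, AltChain] at h ⊢
    refine ⟨hf a (h₁ a (by simp)) b (h₂ b (by simp)) h.1,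
      ih h₂ (fun c hc => h₁ c (by simp [hc])) h.2⟩

lemma sort_image_of_strictMonoOn {f : ℚ → ℚ} {A : Finset ℚ} (hf : StrictMonoOn f A) :
    (A.image f).sort (· ≤ ·) = (A.sort (· ≤ ·)).map f := by
  have h : ((A.sort (· ≤ ·)).map f).toFinset = A.image f := by ext; simp
  have hs : ((A.sort (· ≤ ·)).map f).Pairwise (· < ·) := by
    refine List.pairwise_map.2 (A.sortedLT_sort.pairwise.imp_of_mem fun ha hb hab => ?_)
    exact hf (by simpa using ha) (by simpa using hb) hab
  rw [← h]
  exact (List.toFinset_sort _ (hs.imp fun hab => hab.ne)).2 (hs.imp fun hab => hab.le)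

lemma Wr.of_image_midMap {m v : ℕ} {A B : Finset ℚ} (hA : A ⊆ vPlus m v) (hB : B ⊆ vPlus m v)
    (hiA : Set.InjOn (midMap v) A) (hiB : Set.InjOn (midMap v) B)
    (h : Wr (A.image (midMap v)) (B.image (midMap v))) : Wr A B := by
  have hmono : ∀ {C : Finset ℚ}, C ⊆ vPlus m v → Set.InjOn (midMap v) C →
      StrictMonoOn (midMap v) C := fun {C} hC hi a ha b hb hab => by
    by_contra h'
    rcases lt_or_eq_of_le (not_lt.1 h') with h'' | h''
    · exact hab.not_gt (lt_of_midMap_lt (hC hb) (hC ha) h'')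
    · exact hab.ne' (hi hb ha h'')
  have hlt : ∀ a ∈ vPlus m v, ∀ b ∈ vPlus m v, midMap v a < midMap v b → a < b :=
    fun a ha b hb => lt_of_midMap_lt ha hb
  unfold Wr Intertwines at h ⊢
  rw [Finset.card_image_of_injOn hiA, Finset.card_image_of_injOn hiB,
    sort_image_of_strictMonoOn (hmono hA hiA), sort_image_of_strictMonoOn (hmono hB hiB)] at h
  split_ifs at h ⊢
  · exact AltChain.of_map hlt _ _ (fun a ha => hA (by simpa using ha))
      (fun a ha => hB (by simpa using ha)) h
  · exact AltChain.of_map hlt _ _ (fun a ha => hB (by simpa using ha))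
      (fun a ha => hA (by simpa using ha)) h

/-- **Lemma.** The contraction `[x → v ← y]` is order-preserving with respect to the
second higher Stasheff–Tamari order. -/
theorem contractMid_le2 (m n v : ℕ) (hmn : n + 2 ≤ m) (hv1 : 1 < v) (hvm : v < m)
    (That That' : Finset (Finset ℚ))
    (hThat : IsTriangulation (vPlus m v) n That)
    (hThat' : IsTriangulation (vPlus m v) n That')
    (hle : Le2 (vPlus m v) n That That') :
    Le2 (vSet m) n (contractTri (midMap v) n That) (contractTri (midMap v) n That') := by
  unfold Le2 at hle ⊢
  split_ifs at hle ⊢ with hn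
  · intro A hA B hB hWr
    obtain ⟨A', hA', rfl, hiA⟩ := exists_lift_internalSimps hmn hv1 hvm hThat hA
    obtain ⟨B', hB', rfl, hiB⟩ := exists_lift_internalSimps hmn hv1 hvm hThat' hB
    exact hle A' hA' B' hB' (.of_image_midMap (Finset.mem_powerset.1 (Finset.mem_filter.1 hB').1)
      (Finset.mem_powerset.1 (Finset.mem_filter.1 hA').1) hiB hiA hWr)
  · intro A hA
    obtain ⟨B, hB, rfl, hinj⟩ := exists_lift_internalSimps hmn hv1 hvm hThat' hA
    obtain ⟨R, hR, hBR, hxy⟩ := exists_not_collapsed hThat (hle hB) hinj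
    obtain ⟨hRV, hRc⟩ := hThat.1 R hR
    simp only [internalSimps, contractTri, Finset.mem_filter, Finset.mem_image] at hA ⊢
    refine ⟨hA.1, hA.2.1, ⟨R.image (midMap v), ⟨⟨R, hR, rfl⟩, ?_⟩,
      Finset.image_subset_image hBR⟩, hA.2.2.2⟩
    rw [Finset.card_image_of_injOn (injOn_midMap hRV hxy), hRc]

end HST
end

section
/- Let T, T' be triangulations of C(m,2d) with T <₂ T' (i.e. T ≤₂ T' and T ≠ T'). Suppose that T admits an increasing bistellar flip T'' which is the result of replacing the d-simplex A = (a_0,…,a_d) by the d-simplex B = (b_0,…,b_d). Then T'' ≰₂ T' if and only if there exists ā₀ with a_0 ≤ ā₀ < b_0 such that (ā₀, a_1, …, a_d) ∈ simp(T'). -/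
open scoped Classical

namespace HST

/-- `T''` is the increasing bistellar flip of the triangulation `T` of `C(m, 2d)` replacing
the `d`-simplex `A` by the `d`-simplex `B`: `A ≀ B`, the induced triangulation of
`C(A ∪ B, 2d)` is the lower triangulation, and `T''` is obtained by replacing it with the
upper triangulation. -/
def IsEvenFlip (d : ℕ) (T : Finset (Finset ℚ)) (A B : Finset ℚ)
    (T'' : Finset (Finset ℚ)) : Prop :=
  A.card = d + 1 ∧ B.card = d + 1 ∧ Wr A B ∧
    T.filter (fun S => S ⊆ A ∪ B) = lowerFacets (A ∪ B) (2 * d + 1) ∧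
    T'' = (T \ lowerFacets (A ∪ B) (2 * d + 1)) ∪ upperFacets (A ∪ B) (2 * d + 1)

/-- `a 0 < b 0 < a 1 < b 1 < ⋯ < a d < b d`. -/
def Alternates (d : ℕ) (a b : ℕ → ℚ) : Prop :=
  (∀ i ≤ d, a i < b i) ∧ ∀ i < d, b i < a (i + 1)

/-- The `i`-th smallest element of `A`, counting from zero. -/
noncomputable def nthElt (A : Finset ℚ) (i : ℕ) : ℚ := (A.sort (· ≤ ·)).getD i 0

/-- The set `{a 0, …, a d}`. -/
noncomputable def initImage (d : ℕ) (a : ℕ → ℚ) : Finset ℚ := (Finset.range (d + 1)).image a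

theorem mem_initImage {d : ℕ} {a : ℕ → ℚ} {q : ℚ} :
    q ∈ initImage d a ↔ ∃ i ≤ d, a i = q := by
  simp [initImage]

theorem altChain_map_range (d : ℕ) (a b : ℕ → ℚ) :
    AltChain ((List.range (d + 1)).map a) ((List.range (d + 1)).map b) ↔ Alternates d a b := by
  induction d generalizing a b with
  | zero => simp [AltChain, Alternates]
  | succ d ih =>
    have h := ih (a ∘ Nat.succ) (b ∘ Nat.succ)
    rw [List.range_succ_eq_map, List.map_cons, List.map_cons, List.map_map, List.map_map]
    have ha : (List.range (d + 1)).map (a ∘ Nat.succ) =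
        a 1 :: ((List.range d).map Nat.succ).map (a ∘ Nat.succ) := by
      rw [List.range_succ_eq_map]; simp
    have key : AltChain (a 0 :: (List.range (d + 1)).map (a ∘ Nat.succ))
        (b 0 :: (List.range (d + 1)).map (b ∘ Nat.succ)) ↔
        a 0 < b 0 ∧ b 0 < a 1 ∧ AltChain ((List.range (d + 1)).map (a ∘ Nat.succ))
          ((List.range (d + 1)).map (b ∘ Nat.succ)) := by
      rw [ha, AltChain, AltChain]
    rw [key, h]
    constructor
    · rintro ⟨h0, h1, h2, h3⟩
      refine ⟨fun i hi => ?_, fun i hi => ?_⟩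
      · cases i with
        | zero => exact h0
        | succ i => exact h2 i (by omega)
      · cases i with
        | zero => exact h1
        | succ i => exact h3 i (by omega)
    · rintro ⟨h1, h2⟩
      exact ⟨h1 0 (by omega), h2 0 (by omega), fun i hi => h1 (i + 1) (by omega),
        fun i hi => h2 (i + 1) (by omega)⟩

theorem sort_eq_map_nthElt {A : Finset ℚ} {d : ℕ} (hA : A.card = d + 1) :
    A.sort (· ≤ ·) = (List.range (d + 1)).map (nthElt A) := by
  have hl : (A.sort (· ≤ ·)).length = d + 1 := by rw [Finset.length_sort, hA]
  apply List.ext_getElem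
  · simp [hl]
  · intro i h1 h2
    simp [nthElt, List.getElem?_eq_getElem h1]

theorem wr_iff_alternates {A B : Finset ℚ} {d : ℕ} (hA : A.card = d + 1) (hB : B.card = d + 1) :
    Wr A B ↔ Alternates d (nthElt A) (nthElt B) := by
  rw [Wr, if_pos (hA.trans hB.symm), Intertwines, sort_eq_map_nthElt hA, sort_eq_map_nthElt hB,
    altChain_map_range]

theorem initImage_nthElt {A : Finset ℚ} {d : ℕ} (hA : A.card = d + 1) :
    initImage d (nthElt A) = A := by
  ext q
  rw [← Finset.mem_sort (s := A) (· ≤ ·), sort_eq_map_nthElt hA]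
  simp [initImage]

theorem sort_initImage {d : ℕ} {a : ℕ → ℚ} (ha : StrictMonoOn a (Set.Iic d)) :
    (initImage d a).sort (· ≤ ·) = (List.range (d + 1)).map a := by
  have hs : ((List.range (d + 1)).map a).SortedLT := by
    rw [List.sortedLT_iff_pairwise, List.pairwise_map]
    refine List.pairwise_lt_range.imp_of_mem fun {i j} hi hj hij => ?_
    rw [List.mem_range] at hi hj
    exact ha (by simp; omega) (by simp; omega) hij
  have ht : initImage d a = ((List.range (d + 1)).map a).toFinset := by
    ext q; simp [initImage]
  rw [ht]
  exact (List.toFinset_sort (· ≤ ·) hs.nodup).2 hs.sortedLE.pairwise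

theorem card_initImage {d : ℕ} {a : ℕ → ℚ} (ha : StrictMonoOn a (Set.Iic d)) :
    (initImage d a).card = d + 1 := by
  rw [initImage, Finset.card_image_of_injOn, Finset.card_range]
  exact ha.injOn.mono fun i hi => by simp at hi ⊢; omega

theorem Alternates.le_right {d : ℕ} {a b : ℕ → ℚ} (h : Alternates d a b) {i j : ℕ}
    (hij : i ≤ j) (hj : j ≤ d) : b i ≤ b j := by
  induction j, hij using Nat.le_induction with
  | base => exact le_rfl
  | succ j _ ih =>
    exact ((ih (by omega)).trans_lt ((h.2 j (by omega)).trans (h.1 (j + 1) hj))).le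

theorem Alternates.lt_of_le {d : ℕ} {a b : ℕ → ℚ} (h : Alternates d a b) {i j : ℕ}
    (hij : i ≤ j) (hj : j ≤ d) : a i < b j :=
  (h.1 i (hij.trans hj)).trans_le (h.le_right hij hj)

theorem Alternates.lt_of_lt {d : ℕ} {a b : ℕ → ℚ} (h : Alternates d a b) {i j : ℕ}
    (hij : i < j) (hj : j ≤ d) : b i < a j := by
  obtain ⟨k, rfl⟩ : ∃ k, j = k + 1 := ⟨j - 1, by omega⟩
  exact (h.le_right (by omega) (by omega)).trans_lt (h.2 k (by omega))

theorem Alternates.ne {d : ℕ} {a b : ℕ → ℚ} (h : Alternates d a b) {i j : ℕ}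
    (hi : i ≤ d) (hj : j ≤ d) : a i ≠ b j := by
  rcases le_or_gt i j with hij | hij
  · exact (h.lt_of_le hij hj).ne
  · exact (h.lt_of_lt hij hi).ne'

theorem Alternates.strictMonoOn_left {d : ℕ} {a b : ℕ → ℚ} (h : Alternates d a b) :
    StrictMonoOn a (Set.Iic d) := fun i hi _ hj hij =>
  (h.1 i hi).trans (h.lt_of_lt hij hj)

theorem Alternates.strictMonoOn_right {d : ℕ} {a b : ℕ → ℚ} (h : Alternates d a b) :
    StrictMonoOn b (Set.Iic d) := fun _ _ j hj hij =>
  (h.lt_of_lt hij hj).trans (h.1 j hj)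

theorem Alternates.wr {d : ℕ} {a b : ℕ → ℚ} (h : Alternates d a b) :
    Wr (initImage d a) (initImage d b) := by
  rw [Wr, if_pos, Intertwines, sort_initImage h.strictMonoOn_left,
    sort_initImage h.strictMonoOn_right, altChain_map_range]
  · exact h
  · rw [card_initImage h.strictMonoOn_left, card_initImage h.strictMonoOn_right]

theorem Alternates.disjoint {d : ℕ} {a b : ℕ → ℚ} (h : Alternates d a b) :
    Disjoint (initImage d a) (initImage d b) := by
  rw [Finset.disjoint_left]
  intro q ha hb
  obtain ⟨i, hi, rfl⟩ := mem_initImage.1 ha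
  obtain ⟨j, hj, hq⟩ := mem_initImage.1 hb
  exact h.ne hi hj hq.symm

theorem Alternates.card_union {d : ℕ} {a b : ℕ → ℚ} (h : Alternates d a b) :
    (initImage d a ∪ initImage d b).card = 2 * d + 2 := by
  rw [Finset.card_union_of_disjoint h.disjoint, card_initImage h.strictMonoOn_left,
    card_initImage h.strictMonoOn_right]
  ring

theorem Alternates.erase_right_mem_lowerFacets {d : ℕ} {a b : ℕ → ℚ} (h : Alternates d a b)
    {i : ℕ} (hi : i ≤ d) :
    (initImage d a ∪ initImage d b).erase (b i) ∈
      lowerFacets (initImage d a ∪ initImage d b) (2 * d + 1) := by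
  have hbi : b i ∈ initImage d a ∪ initImage d b :=
    Finset.mem_union_right _ (mem_initImage.2 ⟨i, hi, rfl⟩)
  refine Finset.mem_filter.2 ⟨Finset.mem_powerset.2 (Finset.erase_subset _ _),
    Finset.erase_subset _ _, ?_, ?_⟩
  · rw [Finset.card_erase_of_mem hbi, h.card_union]; rfl
  · intro w hw
    obtain rfl : w = b i := by
      by_contra hne
      simp only [Finset.mem_sdiff, Finset.mem_erase] at hw
      exact hw.2 ⟨hne, hw.1⟩
    have hset : (((initImage d a ∪ initImage d b).erase (b i)).filter fun x => b i < x) =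
        (Finset.Ioc i d).image a ∪ (Finset.Ioc i d).image b := by
      ext q
      simp only [Finset.mem_filter, Finset.mem_erase, Finset.mem_union, mem_initImage,
        Finset.mem_image, Finset.mem_Ioc]
      constructor
      · rintro ⟨⟨-, ⟨j, hj, rfl⟩ | ⟨j, hj, rfl⟩⟩, hlt⟩
        · refine Or.inl ⟨j, ⟨?_, hj⟩, rfl⟩
          by_contra hji
          exact absurd (h.lt_of_le (not_lt.1 hji) hi) hlt.not_gt
        · refine Or.inr ⟨j, ⟨?_, hj⟩, rfl⟩
          by_contra hji
          exact absurd (h.le_right (not_lt.1 hji) hi) hlt.not_ge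
      · rintro (⟨j, ⟨hij, hj⟩, rfl⟩ | ⟨j, ⟨hij, hj⟩, rfl⟩)
        · have := h.lt_of_lt hij hj
          exact ⟨⟨this.ne', Or.inl ⟨j, hj, rfl⟩⟩, this⟩
        · have := h.strictMonoOn_right hi hj hij
          exact ⟨⟨this.ne', Or.inr ⟨j, hj, rfl⟩⟩, this⟩
    have hsub : (↑(Finset.Ioc i d) : Set ℕ) ⊆ Set.Iic d := fun j hj => by
      simp at hj ⊢; omega
    rw [hset, Finset.card_union_of_disjoint,
      Finset.card_image_of_injOn (h.strictMonoOn_left.injOn.mono hsub),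
      Finset.card_image_of_injOn (h.strictMonoOn_right.injOn.mono hsub)]
    · exact ⟨_, rfl⟩
    · refine h.disjoint.mono ?_ ?_ <;>
      · refine Finset.image_subset_image fun j hj => ?_
        simp at hj ⊢; omega

theorem Alternates.erase_left_zero_mem_upperFacets {d : ℕ} {a b : ℕ → ℚ}
    (h : Alternates d a b) :
    (initImage d a ∪ initImage d b).erase (a 0) ∈
      upperFacets (initImage d a ∪ initImage d b) (2 * d + 1) := by
  have ha : a 0 ∈ initImage d a ∪ initImage d b :=
    Finset.mem_union_left _ (mem_initImage.2 ⟨0, d.zero_le, rfl⟩)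
  have hcard : ((initImage d a ∪ initImage d b).erase (a 0)).card = 2 * d + 1 := by
    rw [Finset.card_erase_of_mem ha, h.card_union]; rfl
  refine Finset.mem_filter.2 ⟨Finset.mem_powerset.2 (Finset.erase_subset _ _),
    Finset.erase_subset _ _, hcard, ?_⟩
  intro w hw
  obtain rfl : w = a 0 := by
    by_contra hne
    simp only [Finset.mem_sdiff, Finset.mem_erase] at hw
    exact hw.2 ⟨hne, hw.1⟩
  rw [Finset.filter_true_of_mem, hcard]
  · exact ⟨d, rfl⟩
  · intro q hq
    obtain ⟨hne, hq⟩ := Finset.mem_erase.1 hq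
    rcases Finset.mem_union.1 hq with hq | hq <;> obtain ⟨j, hj, rfl⟩ := mem_initImage.1 hq
    · have hj0 : 0 < j := Nat.pos_of_ne_zero fun h0 => hne (by rw [h0])
      exact h.strictMonoOn_left (by simp) hj hj0
    · exact h.lt_of_le j.zero_le hj

theorem card_lt_card_filter_le {F s : Finset ℚ} {u v : ℚ} (hs : s ⊆ F) (hv : v ∈ F)
    (huv : u < v) (hsv : ∀ x ∈ s, v < x) :
    s.card + 1 ≤ (F.filter (u ≤ ·)).card ∧
      (u ∈ F → s.card + 2 ≤ (F.filter (u ≤ ·)).card) := by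
  have hvs : v ∉ s := fun hv => lt_irrefl _ (hsv v hv)
  have hsub : insert v s ⊆ F.filter (u ≤ ·) := by
    intro x hx
    rcases Finset.mem_insert.1 hx with rfl | hx
    · exact Finset.mem_filter.2 ⟨hv, huv.le⟩
    · exact Finset.mem_filter.2 ⟨hs hx, (huv.trans (hsv x hx)).le⟩
  refine ⟨?_, fun hu => ?_⟩
  · rw [← Finset.card_insert_of_notMem hvs]
    exact Finset.card_le_card hsub
  · have hus : u ∉ insert v s := by
      rw [Finset.mem_insert, not_or]
      exact ⟨huv.ne, fun hu => (hsv u hu).not_gt huv⟩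
    have := Finset.card_le_card
      (Finset.insert_subset (Finset.mem_filter.2 ⟨hu, le_refl u⟩) hsub)
    rwa [Finset.card_insert_of_notMem hus, Finset.card_insert_of_notMem hvs] at this

/-- The right-hand side of an alternating pair of vertex sets is not contained in a facet. -/
theorem Alternates.not_subset_facet {V : Finset ℚ} {d : ℕ} {a b : ℕ → ℚ}
    (h : Alternates d a b) (hV : initImage d a ⊆ V) {F : Finset ℚ} (hF : IsFacet V (2 * d) F) :
    ¬ initImage d b ⊆ F := by
  intro hb
  obtain ⟨p, hp, hcard, hpar⟩ : ∃ p, p < 2 ∧ F.card = 2 * d ∧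
      ∀ w ∈ V, w ∉ F → (F.filter (w ≤ ·)).card % 2 = p := by
    have hfil : ∀ w, w ∉ F → F.filter (w ≤ ·) = F.filter (w < ·) := fun w hw =>
      Finset.filter_congr fun x hx => ⟨fun hwx => hwx.lt_of_ne fun he => hw (he ▸ hx), le_of_lt⟩
    rcases hF with ⟨-, hc, hF⟩ | ⟨-, hc, hF⟩
    · refine ⟨1, by omega, hc, fun w hw hwF => ?_⟩
      rw [hfil w hwF]
      exact Nat.odd_iff.1 (hF w (Finset.mem_sdiff.2 ⟨hw, hwF⟩))
    · refine ⟨0, by omega, hc, fun w hw hwF => ?_⟩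
      rw [hfil w hwF]
      exact Nat.even_iff.1 (hF w (Finset.mem_sdiff.2 ⟨hw, hwF⟩))
  have haV : ∀ i ≤ d, a i ∈ V := fun i hi => hV (mem_initImage.2 ⟨i, hi, rfl⟩)
  have hbF : ∀ i ≤ d, b i ∈ F := fun i hi => hb (mem_initImage.2 ⟨i, hi, rfl⟩)
  have key : ∀ k ≤ d, 2 * k + 1 ≤ (F.filter (a (d - k) ≤ ·)).card ∧
      (p = 0 → 2 * k + 2 ≤ (F.filter (a (d - k) ≤ ·)).card) := by
    intro k hk
    have hp' := hpar _ (haV (d - k) (by omega))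
    induction k with
    | zero =>
      have hc := card_lt_card_filter_le (Finset.empty_subset F) (hbF (d - 0) (by omega))
        (h.1 (d - 0) (by omega)) (by simp)
      rw [Finset.card_empty] at hc
      by_cases hm : a (d - 0) ∈ F
      · have := hc.2 hm; omega
      · have := hp' hm; omega
    | succ k ih =>
      have ih := ih (by omega) (hpar _ (haV (d - k) (by omega)))
      have hlt := h.lt_of_lt (show d - (k + 1) < d - k by omega) (by omega)
      have hc := card_lt_card_filter_le (Finset.filter_subset (a (d - k) ≤ ·) F)
        (hbF (d - (k + 1)) (by omega)) (h.1 (d - (k + 1)) (by omega))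
        (fun x hx => hlt.trans_le (Finset.mem_filter.1 hx).2)
      by_cases hm : a (d - (k + 1)) ∈ F
      · have := hc.2 hm; omega
      · have := hp' hm; omega
  have h1 := (key d le_rfl).1
  have h2 := Finset.card_filter_le F (a (d - d) ≤ ·)
  omega

theorem initImage_update_zero {d : ℕ} {a : ℕ → ℚ} (ha : StrictMonoOn a (Set.Iic d)) (t : ℚ) :
    initImage d (Function.update a 0 t) = insert t ((initImage d a).erase (a 0)) := by
  ext q
  simp only [mem_initImage, Finset.mem_insert, Finset.mem_erase]
  constructor
  · rintro ⟨i, hi, rfl⟩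
    rcases Nat.eq_zero_or_pos i with rfl | h0
    · simp
    · rw [Function.update_of_ne h0.ne']
      exact Or.inr ⟨(ha (by simp) hi h0).ne', i, hi, rfl⟩
  · rintro (rfl | ⟨hne, i, hi, rfl⟩)
    · exact ⟨0, d.zero_le, by simp⟩
    · exact ⟨i, hi, Function.update_of_ne (fun h0 => hne (by rw [h0])) _ _⟩

theorem min'_initImage {d : ℕ} {a : ℕ → ℚ} (ha : StrictMonoOn a (Set.Iic d))
    (hne : (initImage d a).Nonempty) : (initImage d a).min' hne = a 0 := by
  refine le_antisymm (Finset.min'_le _ _ (mem_initImage.2 ⟨0, d.zero_le, rfl⟩)) ?_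
  refine Finset.le_min' _ _ _ fun q hq => ?_
  obtain ⟨i, hi, rfl⟩ := mem_initImage.1 hq
  exact ha.monotoneOn (by simp) hi i.zero_le

/-- An internal simplex `Y ≠ B` on the vertices `A ∪ B` lies in every triangulation containing
the lower triangulation of `A ∪ B`. -/
theorem Alternates.mem_internalSimps_of_subset {V : Finset ℚ} {T : Finset (Finset ℚ)} {d : ℕ}
    {a b : ℕ → ℚ} (h : Alternates d a b) (hV : initImage d a ∪ initImage d b ⊆ V)
    (hlow : lowerFacets (initImage d a ∪ initImage d b) (2 * d + 1) ⊆ T) {Y : Finset ℚ}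
    (hY : Y ⊆ initImage d a ∪ initImage d b) (hcard : Y.card = d + 1) (hne : Y ≠ initImage d b)
    (hint : ∀ F, IsFacet V (2 * d) F → ¬Y ⊆ F) : Y ∈ internalSimps V (2 * d) T := by
  obtain ⟨i, hi, hiY⟩ : ∃ i ≤ d, b i ∉ Y := by
    by_contra! hall
    refine hne (Finset.eq_of_subset_of_card_le (fun q hq => ?_) ?_).symm
    · obtain ⟨i, hi, rfl⟩ := mem_initImage.1 hq
      exact hall i hi
    · rw [hcard, card_initImage h.strictMonoOn_right]
  refine Finset.mem_filter.2 ⟨Finset.mem_powerset.2 (hY.trans hV), by omega,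
    ⟨_, hlow (h.erase_right_mem_lowerFacets hi), fun q hq => ?_⟩, hint⟩
  exact Finset.mem_erase.2 ⟨fun he => hiY (he ▸ hq), hY hq⟩

/-- If no simplex on `A ∪ B` other than `B` is intertwined by `X`, but `B` is, then `X` and `A`
agree except possibly in their least elements. -/
theorem Alternates.eq_of_forall_not_alternates {d : ℕ} {a b x : ℕ → ℚ} (h : Alternates d a b)
    (hx : Alternates d x b)
    (hno : ∀ y, initImage d y ⊆ initImage d a ∪ initImage d b → initImage d y ≠ initImage d b →
      ¬Alternates d x y) :
    a 0 ≤ x 0 ∧ ∀ i, 0 < i → i ≤ d → x i = a i := by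
  have hupd : ∀ i ≤ d, ∀ j ≤ d, ¬Alternates d x (Function.update b j (a i)) := by
    intro i hi j hj
    have hmem : a i ∈ initImage d (Function.update b j (a i)) :=
      mem_initImage.2 ⟨j, hj, Function.update_self ..⟩
    refine hno _ (fun q hq => ?_) fun he => ?_
    · obtain ⟨k, hk, rfl⟩ := mem_initImage.1 hq
      by_cases hkj : k = j
      · rw [hkj, Function.update_self]
        exact Finset.mem_union_left _ (mem_initImage.2 ⟨i, hi, rfl⟩)
      · rw [Function.update_of_ne hkj]
        exact Finset.mem_union_right _ (mem_initImage.2 ⟨k, hk, rfl⟩)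
    · rw [he] at hmem
      exact Finset.disjoint_left.1 h.disjoint (mem_initImage.2 ⟨i, hi, rfl⟩) hmem
  have halt : ∀ j t, x j < t → (j < d → t < x (j + 1)) →
      Alternates d x (Function.update b j t) := by
    intro j t h1 h2
    refine ⟨fun k hk => ?_, fun k hk => ?_⟩ <;> by_cases hkj : k = j
    · rw [hkj, Function.update_self]; exact h1
    · rw [Function.update_of_ne hkj]; exact hx.1 k hk
    · subst hkj; rw [Function.update_self]; exact h2 hk
    · rw [Function.update_of_ne hkj]; exact hx.2 k hk
  have hge : ∀ i ≤ d, a i ≤ x i := by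
    intro i hi
    by_contra! hlt
    exact hupd i hi i hi (halt i _ hlt fun hid => (h.1 i hi).trans (hx.2 i hid))
  refine ⟨hge 0 d.zero_le, fun i h0 hi => le_antisymm ?_ (hge i hi)⟩
  by_contra! hlt
  obtain ⟨j, rfl⟩ : ∃ j, i = j + 1 := ⟨i - 1, by omega⟩
  exact hupd (j + 1) hi j (by omega)
    (halt j _ ((hx.1 j (by omega)).trans (h.2 j (by omega))) fun _ => hlt)

/-- **Lemma (obstructions).** The flipped triangulation `T''` fails to lie below `T'` in
the second order if and only if `T'` contains an obstruction `(ā₀, a₁, …, a_d)` with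
`a₀ ≤ ā₀ < b₀`. -/
theorem obstruction_iff (m d : ℕ) (hd : 1 ≤ d) (hm : 2 * d + 2 ≤ m)
    (T T' : Finset (Finset ℚ))
    (hT : IsTriangulation (vSet m) (2 * d) T)
    (hT' : IsTriangulation (vSet m) (2 * d) T')
    (hle : Le2Even (vSet m) d T T') (hne : T ≠ T')
    (A B : Finset ℚ) (T'' : Finset (Finset ℚ))
    (hflip : IsEvenFlip d T A B T'')
    (hT'' : IsTriangulation (vSet m) (2 * d) T'')
    (hAne : A.Nonempty) (hBne : B.Nonempty) :
    ¬Le2Even (vSet m) d T'' T' ↔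
      ∃ a0bar : ℚ, A.min' hAne ≤ a0bar ∧ a0bar < B.min' hBne ∧
        insert a0bar (A.erase (A.min' hAne)) ∈ internalSimps (vSet m) (2 * d) T' := by
  obtain ⟨hAc, hBc, hwr, hind, hT''eq⟩ := hflip
  have h := (wr_iff_alternates hAc hBc).1 hwr
  obtain ⟨a, ha⟩ : ∃ a, a = nthElt A := ⟨_, rfl⟩
  obtain ⟨b, hb⟩ : ∃ b, b = nthElt B := ⟨_, rfl⟩
  have hAi : initImage d a = A := ha ▸ initImage_nthElt hAc
  have hBi : initImage d b = B := hb ▸ initImage_nthElt hBc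
  rw [← ha, ← hb] at h
  have hwrB : ∀ X : Finset ℚ, X.card = d + 1 → Wr X B → Alternates d (nthElt X) b :=
    fun X hX hw => hb ▸ (wr_iff_alternates hX hBc).1 hw
  clear hb ha hwr
  subst hAi hBi
  rw [min'_initImage h.strictMonoOn_left, min'_initImage h.strictMonoOn_right]
  have hlow : lowerFacets (initImage d a ∪ initImage d b) (2 * d + 1) ⊆ T := by
    rw [← hind]; exact Finset.filter_subset _ _
  have hV : initImage d a ∪ initImage d b ⊆ vSet m := by
    intro q hq
    by_cases hq0 : q = b 0
    · refine (hT.1 _ (hlow (h.erase_right_mem_lowerFacets hd))).1 (Finset.mem_erase.2 ⟨?_, hq⟩)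
      rw [hq0]
      exact (h.strictMonoOn_right (by simp) hd Nat.zero_lt_one).ne
    · exact (hT.1 _ (hlow (h.erase_right_mem_lowerFacets d.zero_le))).1
        (Finset.mem_erase.2 ⟨hq0, hq⟩)
  have hcard : ∀ {T Y}, Y ∈ internalSimps (vSet m) (2 * d) T → Y.card = d + 1 := fun hY => by
    rw [(Finset.mem_filter.1 hY).2.1]; omega
  constructor
  · intro hnle
    simp only [Le2Even, not_forall, not_not] at hnle
    obtain ⟨Y, hY, X, hX, hXY⟩ := hnle
    obtain ⟨-, hYc, ⟨S, hS, hYS⟩, hYint⟩ := Finset.mem_filter.1 hY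
    have hYB : Y = initImage d b := by
      by_contra hne
      refine hle Y ?_ X hX hXY
      rw [hT''eq, Finset.mem_union, Finset.mem_sdiff] at hS
      rcases hS with hS | hS
      · exact Finset.mem_filter.2 ⟨(Finset.mem_filter.1 hY).1, hYc, ⟨S, hS.1, hYS⟩, hYint⟩
      · exact h.mem_internalSimps_of_subset hV hlow
          (hYS.trans (Finset.mem_powerset.1 (Finset.mem_filter.1 hS).1)) (hcard hY) hne hYint
    have hXi := initImage_nthElt (hcard hX)
    have hx := hwrB X (hcard hX) (hYB ▸ hXY)
    obtain ⟨h0, heq⟩ := h.eq_of_forall_not_alternates hx fun y hy hne hxy => by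
      refine hle _ (h.mem_internalSimps_of_subset hV hlow hy
        (card_initImage hxy.strictMonoOn_right) hne fun F hF => hxy.not_subset_facet ?_ hF) X hX ?_
      · rw [hXi]
        exact Finset.mem_powerset.1 (Finset.mem_filter.1 hX).1
      · rw [← hXi]
        exact hxy.wr
    refine ⟨nthElt X 0, h0, hx.1 0 d.zero_le, ?_⟩
    rw [← initImage_update_zero h.strictMonoOn_left]
    convert hX using 1
    rw [← hXi]
    refine Finset.image_congr fun i hi => ?_
    rcases Nat.eq_zero_or_pos i with rfl | hpos
    · simp [hXi]
    · rw [Function.update_of_ne hpos.ne']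
      simp only [Finset.coe_range, Set.mem_Iio] at hi
      exact (heq i hpos (by omega)).symm
  · rintro ⟨t, -, htb, hmem⟩ hle''
    rw [← initImage_update_zero h.strictMonoOn_left] at hmem
    refine hle'' (initImage d b) ?_ _ hmem (Alternates.wr ⟨fun i hi => ?_, fun i hi => ?_⟩)
    · refine Finset.mem_filter.2 ⟨Finset.mem_powerset.2 (Finset.subset_union_right.trans hV),
        by omega, ⟨(initImage d a ∪ initImage d b).erase (a 0), ?_, fun q hq => ?_⟩,
        fun F hF => h.not_subset_facet (Finset.subset_union_left.trans hV) hF⟩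
      · rw [hT''eq]
        exact Finset.mem_union_right _ h.erase_left_zero_mem_upperFacets
      · refine Finset.mem_erase.2 ⟨?_, Finset.mem_union_right _ hq⟩
        rintro rfl
        exact Finset.disjoint_left.1 h.disjoint (mem_initImage.2 ⟨0, d.zero_le, rfl⟩) hq
    · rcases Nat.eq_zero_or_pos i with rfl | hpos
      · simpa using htb
      · rw [Function.update_of_ne hpos.ne']; exact h.1 i hi
    · rw [Function.update_of_ne (by omega)]; exact h.2 i hi

end HST
end

section
/- Let d ≥ 1, m ≥ 2d+3, 1 < v < m, and let G ⊆ [m]∖{v} with #G = 2d−1. If G = F ∩ F' where F is an upper facet and F' is a lower facet of the vertex figure C(m,2d+1)∖v, then G is a facet of the cyclic polytope C([m]∖{v}, 2d−1) on the ordered vertex set [m]∖{v}; moreover G∪{x,y} is a facet of C([m]_{v+}, 2d+1). -/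
open scoped Classical

namespace HST

/-- `G` decomposes as a disjoint union of pairs of consecutive numbers, with pair-starts
`P`, together with the endpoint `e ∈ {1, m}`. -/
def PairDecomp (m : ℕ) (G P : Finset ℚ) (e : ℚ) : Prop :=
  (e = 1 ∨ e = (m : ℚ)) ∧ (∀ p ∈ P, p + 1 ∉ P) ∧
    e ∉ P ∧ e ∉ P.image (fun p => p + 1) ∧
    G = insert e (P ∪ P.image fun p => p + 1)

/-- `F` is a lower facet of the vertex figure `C(m, n) ∖ v`: `F ∪ {v}` is a facet of
`C(m, n)` in which `v` is paired with `v + 1`. -/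
def VFLowerFacet (m : ℕ) (v : ℚ) (n : ℕ) (F : Finset ℚ) : Prop :=
  v ∉ F ∧ IsFacet (vSet m) n (insert v F) ∧
    ∃ P e, PairDecomp m (insert v F) P e ∧ v ∈ P

/-- `F` is an upper facet of the vertex figure `C(m, n) ∖ v`: `F ∪ {v}` is a facet of
`C(m, n)` in which `v` is paired with `v - 1`. -/
def VFUpperFacet (m : ℕ) (v : ℚ) (n : ℕ) (F : Finset ℚ) : Prop :=
  v ∉ F ∧ IsFacet (vSet m) n (insert v F) ∧
    ∃ P e, PairDecomp m (insert v F) P e ∧ v - 1 ∈ P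

/-- The number of elements of `A` strictly above `w`. -/
noncomputable def numAbove (A : Finset ℚ) (w : ℚ) : ℕ := (A.filter fun x => w < x).card

theorem numAbove_insert {A : Finset ℚ} {a : ℚ} (ha : a ∉ A) (w : ℚ) :
    numAbove (insert a A) w = (if w < a then 1 else 0) + numAbove A w := by
  simp only [numAbove, Finset.card_filter]
  rw [Finset.sum_insert ha]

theorem exists_nat_of_mem_vSet {m : ℕ} {w : ℚ} (hw : w ∈ vSet m) :
    ∃ k : ℕ, 1 ≤ k ∧ k ≤ m ∧ w = k := by
  simp [vSet, Finset.bind_def] at hw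
  obtain ⟨k, ⟨h1, h2⟩, h3⟩ := hw
  exact ⟨k, h1, h2, h3.symm⟩

/-- The parity of the number of elements above `w` in a disjoint union of pairs of
consecutive numbers and an endpoint: only the endpoint and the pair starting at `w`
contribute. -/
theorem numAbove_mod_two_of_pairDecomp {m : ℕ} {A P : Finset ℚ} {e w : ℚ} (hm : 1 < m)
    (hA : A ⊆ vSet m) (h : PairDecomp m A P e) (hw : w ∈ vSet m) (hwe : w ≠ e) :
    numAbove A w % 2 = ((if e = m then 1 else 0) + if w ∈ P then 1 else 0) % 2 := by
  obtain ⟨he, hP, heP, heP', rfl⟩ := h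
  have hdisj : Disjoint P (P.image fun p => p + 1) := by
    rw [Finset.disjoint_left]
    intro p hp hp'
    obtain ⟨q, hq, rfl⟩ := Finset.mem_image.1 hp'
    exact hP q hq hp
  obtain ⟨k, hk1, hkm, rfl⟩ := exists_nat_of_mem_vSet hw
  have hshift : ∀ p ∈ P, (if (k : ℚ) < p + 1 then 1 else 0) =
      (if (k : ℚ) < p then 1 else 0) + if (k : ℚ) = p then 1 else 0 := by
    intro p hp
    obtain ⟨j, -, -, rfl⟩ := exists_nat_of_mem_vSet
      (hA (Finset.mem_insert_of_mem (Finset.mem_union_left _ hp)))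
    norm_cast
    split_ifs <;> omega
  have hend : (if (k : ℚ) < e then 1 else 0) = if e = (m : ℚ) then 1 else 0 := by
    rcases he with rfl | rfl
    · have h1 : ¬ (k : ℚ) < 1 := by norm_cast; omega
      have h2 : ¬ (1 : ℚ) = m := by norm_cast; omega
      simp [h1, h2]
    · have h1 : (k : ℚ) < m := by
        have : k ≠ m := fun h => hwe (by rw [h])
        norm_cast; omega
      simp [h1]
  have hnot : e ∉ P ∪ P.image fun p => p + 1 := by
    simp only [Finset.mem_union, not_or]
    exact ⟨heP, heP'⟩
  rw [numAbove_insert hnot, hend, numAbove, Finset.card_filter, Finset.sum_union hdisj,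
    Finset.sum_image (by simp), Finset.sum_congr rfl hshift, Finset.sum_add_distrib,
    Finset.sum_ite_eq]
  omega

theorem isFacet_of_numAbove_mod_two {V G : Finset ℚ} {n r : ℕ} (hGV : G ⊆ V)
    (hcard : G.card = n) (h : ∀ w ∈ V \ G, numAbove G w % 2 = r % 2) : IsFacet V n G := by
  rcases Nat.even_or_odd r with hr | hr
  · refine Or.inr ⟨hGV, hcard, fun w hw => ?_⟩
    exact Nat.even_iff.2 ((h w hw).trans (Nat.even_iff.1 hr))
  · refine Or.inl ⟨hGV, hcard, fun w hw => ?_⟩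
    exact Nat.odd_iff.2 ((h w hw).trans (Nat.odd_iff.1 hr))

theorem PairDecomp.endpoint_mem {m : ℕ} {A P : Finset ℚ} {e : ℚ} (h : PairDecomp m A P e) :
    e ∈ A := by
  rw [h.2.2.2.2]
  exact Finset.mem_insert_self _ _

theorem PairDecomp.subset {m : ℕ} {A P : Finset ℚ} {e : ℚ} (h : PairDecomp m A P e) :
    P ⊆ A := by
  rw [h.2.2.2.2]
  exact fun p hp => Finset.mem_insert_of_mem (Finset.mem_union_left _ hp)

theorem IsFacet.subset {V F : Finset ℚ} {n : ℕ} (h : IsFacet V n F) : F ⊆ V :=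
  h.elim (fun h => h.1) fun h => h.1

theorem IsFacet.card_eq {V F : Finset ℚ} {n : ℕ} (h : IsFacet V n F) : F.card = n :=
  h.elim (fun h => h.2.1) fun h => h.2.1

theorem exists_insert_eq_of_card {G F : Finset ℚ} (h : G ⊆ F) (hc : F.card = G.card + 1) :
    ∃ a ∉ G, F = insert a G := by
  obtain ⟨a, ha⟩ := Finset.card_eq_one.1
    (show (F \ G).card = 1 by rw [Finset.card_sdiff_of_subset h]; omega)
  refine ⟨a, ?_, ?_⟩
  · exact (Finset.mem_sdiff.1 (ha ▸ Finset.mem_singleton_self a)).2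
  · rw [Finset.insert_eq, ← ha, Finset.sdiff_union_of_subset h]

/-- Off `v` and `G`, the parity of the number of elements of `G = F ∩ F'` above a vertex is
constant. -/
theorem numAbove_inter_mod_two {m n : ℕ} {v a b : ℚ} {G : Finset ℚ} (hm : 1 < m)
    (hv : v ∈ vSet m) (hv1 : v ≠ 1) (hvm : v ≠ m)
    (ha : a ∉ G) (hb : b ∉ G) (hab : a ≠ b)
    (hF : VFUpperFacet m v n (insert a G)) (hF' : VFLowerFacet m v n (insert b G))
    {w : ℚ} (hw : w ∈ vSet m) (hwv : w ≠ v) (hwG : w ∉ G) :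
    numAbove G w % 2 = numAbove G a % 2 := by
  obtain ⟨hvF, hA, P, e, hP, hvP⟩ := hF
  obtain ⟨hvF', hA', P', e', hP', hvP'⟩ := hF'
  have hva : v ≠ a := fun h => hvF (h ▸ Finset.mem_insert_self _ _)
  have hvb : v ≠ b := fun h => hvF' (h ▸ Finset.mem_insert_self _ _)
  have hve : v ≠ e := by rcases hP.1 with rfl | rfl <;> assumption
  have hve' : v ≠ e' := by rcases hP'.1 with rfl | rfl <;> assumption
  have hvnP : v ∉ P := fun h => hP.2.1 _ hvP (by simpa using h)
  have hcount : ∀ u, numAbove (insert v (insert a G)) u =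
      (if u < v then 1 else 0) + ((if u < a then 1 else 0) + numAbove G u) := fun u => by
    rw [numAbove_insert hvF, numAbove_insert ha]
  have hcount' : ∀ u, numAbove (insert v (insert b G)) u =
      (if u < v then 1 else 0) + ((if u < b then 1 else 0) + numAbove G u) := fun u => by
    rw [numAbove_insert hvF', numAbove_insert hb]
  have key : ∀ u ∈ vSet m, u ∉ insert v (insert a G) →
      ((if u < v then 1 else 0) + ((if u < a then 1 else 0) + numAbove G u)) % 2 =
        (if e = m then 1 else 0) % 2 := fun u hu huA => by
    have := numAbove_mod_two_of_pairDecomp hm hA.subset hP hu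
      (fun h => huA (h ▸ hP.endpoint_mem))
    rwa [hcount, if_neg fun h => huA (hP.subset h)] at this
  have key' : ∀ u ∈ vSet m, u ∉ insert v (insert b G) →
      ((if u < v then 1 else 0) + ((if u < b then 1 else 0) + numAbove G u)) % 2 =
        (if e' = m then 1 else 0) % 2 := fun u hu huA => by
    have := numAbove_mod_two_of_pairDecomp hm hA'.subset hP' hu
      (fun h => huA (h ▸ hP'.endpoint_mem))
    rwa [hcount', if_neg fun h => huA (hP'.subset h)] at this
  have hatv := numAbove_mod_two_of_pairDecomp hm hA.subset hP hv hve
  have hatv' := numAbove_mod_two_of_pairDecomp hm hA'.subset hP' hv hve'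
  rw [hcount, if_neg (lt_irrefl v), if_neg hvnP] at hatv
  rw [hcount', if_neg (lt_irrefl v), if_pos hvP'] at hatv'
  have hata := key' a (hA.subset (by simp)) (by simp [hva.symm, hab, ha])
  have hatb := key b (hA'.subset (by simp)) (by simp [hvb.symm, hab.symm, hb])
  rcases eq_or_ne w a with rfl | hwa
  · rfl
  generalize (if e = (m : ℚ) then 1 else 0 : ℕ) = r at *
  generalize (if e' = (m : ℚ) then 1 else 0 : ℕ) = r' at *
  have lva := lt_or_gt_of_ne hva
  have lvb := lt_or_gt_of_ne hvb
  have lab := lt_or_gt_of_ne hab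
  rcases eq_or_ne w b with rfl | hwb
  · clear key key' hcount hcount'
    rcases lva with h1 | h1 <;> rcases lvb with h2 | h2 <;> rcases lab with h3 | h3 <;>
      simp only [h1, h2, h3, h1.not_gt, h2.not_gt, h3.not_gt, if_true, if_false] at * <;> omega
  have hatw := key w hw (by simp [hwv, hwa, hwG])
  have hatw' := key' w hw (by simp [hwv, hwb, hwG])
  have lwv := lt_or_gt_of_ne hwv
  have lwa := lt_or_gt_of_ne hwa
  have lwb := lt_or_gt_of_ne hwb
  clear key key' hcount hcount'
  rcases lva with h1 | h1 <;> rcases lvb with h2 | h2 <;> rcases lab with h3 | h3 <;>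
    rcases lwv with h4 | h4 <;> rcases lwa with h5 | h5 <;> rcases lwb with h6 | h6 <;>
    simp only [h1, h2, h3, h4, h5, h6, h1.not_gt, h2.not_gt, h3.not_gt, h4.not_gt, h5.not_gt,
      h6.not_gt, if_true, if_false] at hata hatb hatv hatv' hatw hatw' <;>
    first | omega | (exfalso; linarith)

/-- Replacing `v` by the two vertices `x < y` and adding both of them preserves facets. -/
theorem IsFacet.insert_xOf_yOf {m v n : ℕ} {G : Finset ℚ}
    (h : IsFacet ((vSet m).erase (v : ℚ)) n G) :
    IsFacet (vPlus m v) (n + 2) (insert (xOf v) (insert (yOf v) G)) := by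
  have hx : ∀ k : ℕ, (k : ℚ) ≠ xOf v := fun k hk => by
    have : (3 * k + 1 : ℚ) = 3 * v := by rw [hk, xOf]; ring
    norm_cast at this; omega
  have hy : ∀ k : ℕ, (k : ℚ) ≠ yOf v := fun k hk => by
    have : (3 * k : ℚ) = 3 * v + 1 := by rw [hk, yOf]; ring
    norm_cast at this; omega
  have hyG : yOf v ∉ G := fun hG => by
    obtain ⟨k, -, -, hk⟩ := exists_nat_of_mem_vSet (Finset.mem_of_mem_erase (h.subset hG))
    exact hy k hk.symm
  have hxG : xOf v ∉ insert (yOf v) G := fun hG => by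
    rcases Finset.mem_insert.1 hG with hG | hG
    · simp only [xOf, yOf] at hG; linarith
    · obtain ⟨k, -, -, hk⟩ := exists_nat_of_mem_vSet (Finset.mem_of_mem_erase (h.subset hG))
      exact hx k hk.symm
  have hsub : insert (xOf v) (insert (yOf v) G) ⊆ vPlus m v :=
    Finset.insert_subset_insert _ (Finset.insert_subset_insert _ h.subset)
  have hcard : (insert (xOf v) (insert (yOf v) G)).card = n + 2 := by
    rw [Finset.card_insert_of_notMem hxG, Finset.card_insert_of_notMem hyG, h.card_eq]
  have hpar : ∀ w ∈ vPlus m v \ insert (xOf v) (insert (yOf v) G),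
      w ∈ (vSet m).erase (v : ℚ) \ G ∧
        numAbove (insert (xOf v) (insert (yOf v) G)) w % 2 = numAbove G w % 2 := by
    intro w hw
    simp only [vPlus, Finset.mem_sdiff, Finset.mem_insert, not_or] at hw
    obtain ⟨hwV, hwx, hwy, hwG⟩ := hw
    have hwV : w ∈ (vSet m).erase (v : ℚ) := by tauto
    refine ⟨Finset.mem_sdiff.2 ⟨hwV, hwG⟩, ?_⟩
    rw [numAbove_insert hxG, numAbove_insert hyG]
    have hiff : w < xOf v ↔ w < yOf v := by
      obtain ⟨hne, hw⟩ := Finset.mem_erase.1 hwV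
      obtain ⟨k, -, -, rfl⟩ := exists_nat_of_mem_vSet hw
      have hkv : k ≠ v := fun h => hne (by rw [h])
      simp only [xOf, yOf]
      rcases lt_or_gt_of_ne hkv with hlt | hlt
      · have : (k : ℚ) + 1 ≤ v := by exact_mod_cast hlt
        constructor <;> intro <;> linarith
      · have : (v : ℚ) + 1 ≤ k := by exact_mod_cast hlt
        constructor <;> intro <;> linarith
    simp only [hiff]
    split_ifs <;> omega
  rcases h with h | h
  · refine isFacet_of_numAbove_mod_two (r := 1) hsub hcard fun w hw => ?_
    rw [(hpar w hw).2]
    exact Nat.odd_iff.1 (h.2.2 w (hpar w hw).1)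
  · refine isFacet_of_numAbove_mod_two (r := 0) hsub hcard fun w hw => ?_
    rw [(hpar w hw).2]
    exact Nat.even_iff.1 (h.2.2 w (hpar w hw).1)

/-- **Lemma.** The intersection of an upper facet and a lower facet of the vertex figure
`C(m, 2d+1) ∖ v` of size `2d - 1` is a facet of `C([m] ∖ {v}, 2d - 1)`, and adding
`{x, y}` gives a facet of `C([m]_{v+}, 2d + 1)`. -/
theorem ul_facet_intersection (d m v : ℕ) (hd : 1 ≤ d) (hm : 2 * d + 3 ≤ m)
    (hv1 : 1 < v) (hvm : v < m)
    (G F F' : Finset ℚ) (hG : G ⊆ (vSet m).erase (v : ℚ)) (hGcard : G.card = 2 * d - 1)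
    (hF : VFUpperFacet m (v : ℚ) (2 * d + 1) F)
    (hF' : VFLowerFacet m (v : ℚ) (2 * d + 1) F')
    (hGeq : G = F ∩ F') :
    IsFacet ((vSet m).erase (v : ℚ)) (2 * d - 1) G ∧
    IsFacet (vPlus m v) (2 * d + 1) (insert (xOf v) (insert (yOf v) G)) := by
  have hFcard : F.card = G.card + 1 := by
    have := hF.2.1.card_eq
    rw [Finset.card_insert_of_notMem hF.1] at this
    omega
  have hFcard' : F'.card = G.card + 1 := by
    have := hF'.2.1.card_eq
    rw [Finset.card_insert_of_notMem hF'.1] at this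
    omega
  obtain ⟨a, ha, rfl⟩ := exists_insert_eq_of_card
    (hGeq ▸ Finset.inter_subset_left : G ⊆ F) hFcard
  obtain ⟨b, hb, rfl⟩ := exists_insert_eq_of_card
    (hGeq ▸ Finset.inter_subset_right : G ⊆ F') hFcard'
  have hab : a ≠ b := by
    rintro rfl
    rw [Finset.inter_self] at hGeq
    exact ha (hGeq ▸ Finset.mem_insert_self a G)
  have hv : (v : ℚ) ∈ vSet m := hF.2.1.subset (Finset.mem_insert_self _ _)
  have hfacet : IsFacet ((vSet m).erase (v : ℚ)) (2 * d - 1) G := by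
    refine isFacet_of_numAbove_mod_two (r := numAbove G a) hG hGcard fun w hw => ?_
    obtain ⟨hwV, hwG⟩ := Finset.mem_sdiff.1 hw
    obtain ⟨hwv, hwV⟩ := Finset.mem_erase.1 hwV
    exact numAbove_inter_mod_two (by omega) hv (by norm_cast; omega) (by norm_cast; omega)
      ha hb hab hF hF' hwV hwv hwG
  refine ⟨hfacet, ?_⟩
  have hn : 2 * d + 1 = 2 * d - 1 + 2 := by omega
  rw [hn]
  exact hfacet.insert_xOf_yOf

end HST
end
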